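/- For any discrete 1-form A and any two r-forms Φ, Ω (r = 0, 1 or 2) on the combinatorial N×M torus, the operator Δ_A^c = d_A^c δ_A^c + δ_A^c d_A^c is self-adjoint: (Δ_A^cΦ, Ω)_V = (Φ, Δ_A^cΩ)_V. -/

import Mathlib

open Matrix BigOperators

noncomputable section

/-- 2×2 complex matrices. -/
abbrev Mat : Type := Matrix (Fin 2) (Fin 2) ℂ

/-- A discrete 0-form on the combinatorial N×M torus. -/
abbrev Form0 (N M : ℕ) : Type := ZMod N → ZMod M → Mat
/-- A discrete 1-form (pair of component families). -/
abbrev Form1 (N M : ℕ) : Type := Form0 N M × Form0 N M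
/-- A discrete 2-form. -/
abbrev Form2 (N M : ℕ) : Type := ZMod N → ZMod M → Mat

variable {N M : ℕ}

/-- Coboundary on 0-forms. -/
def d0 (Φ : Form0 N M) : Form1 N M :=
  (fun k s => Φ (k + 1) s - Φ k s, fun k s => Φ k (s + 1) - Φ k s)

/-- Coboundary on 1-forms. -/
def d1 (Ω : Form1 N M) : Form2 N M :=
  fun k s => Ω.2 (k + 1) s - Ω.2 k s - Ω.1 k (s + 1) + Ω.1 k s

/-- Cup product of two 0-forms. -/
def cup00 (Φ Ψ : Form0 N M) : Form0 N M := fun k s => Φ k s * Ψ k s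

/-- Cup product of a 0-form and a 1-form. -/
def cup01 (Φ : Form0 N M) (Ω : Form1 N M) : Form1 N M :=
  (fun k s => Φ k s * Ω.1 k s, fun k s => Φ k s * Ω.2 k s)

/-- Cup product of a 1-form and a 0-form. -/
def cup10 (Ω : Form1 N M) (Φ : Form0 N M) : Form1 N M :=
  (fun k s => Ω.1 k s * Φ (k + 1) s, fun k s => Ω.2 k s * Φ k (s + 1))

/-- Cup product of a 0-form and a 2-form. -/
def cup02 (Φ : Form0 N M) (Ψ : Form2 N M) : Form2 N M := fun k s => Φ k s * Ψ k s

/-- Cup product of a 2-form and a 0-form. -/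
def cup20 (Ψ : Form2 N M) (Φ : Form0 N M) : Form2 N M :=
  fun k s => Ψ k s * Φ (k + 1) (s + 1)

/-- Cup product of two 1-forms. -/
def cup11 (Ω Θ : Form1 N M) : Form2 N M :=
  fun k s => Ω.1 k s * Θ.2 (k + 1) s - Ω.2 k s * Θ.1 k (s + 1)

/-- Star operator on 0-forms. -/
def star0 (Φ : Form0 N M) : Form2 N M := fun k s => Φ k s

/-- Star operator on 1-forms. -/
def star1 (Ω : Form1 N M) : Form1 N M :=
  (fun k s => -Ω.2 k (s - 1), fun k s => Ω.1 (k - 1) s)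

/-- Star operator on 2-forms. -/
def star2 (Ψ : Form2 N M) : Form0 N M := fun k s => Ψ (k - 1) (s - 1)

/-- Inverse star, taking 0-forms to 2-forms (inverse of `star2`). -/
def starInv0 (Φ : Form0 N M) : Form2 N M := fun k s => Φ (k + 1) (s + 1)

/-- Inverse star on 1-forms (inverse of `star1`). -/
def starInv1 (Ω : Form1 N M) : Form1 N M :=
  (fun k s => Ω.2 (k + 1) s, fun k s => -Ω.1 k (s + 1))

/-- Inverse star, taking 2-forms to 0-forms (inverse of `star0`). -/
def starInv2 (Ψ : Form2 N M) : Form0 N M := fun k s => Ψ k s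

/-- Codifferential on 1-forms. -/
def delta1 (Ω : Form1 N M) : Form0 N M :=
  fun k s => Ω.1 (k - 1) s - Ω.1 k s + Ω.2 k (s - 1) - Ω.2 k s

/-- Codifferential on 2-forms. -/
def delta2 (Ψ : Form2 N M) : Form1 N M :=
  (fun k s => Ψ k s - Ψ k (s - 1), fun k s => -(Ψ k s - Ψ (k - 1) s))

/-- Covariant exterior derivative on 0-forms: `d_A Φ = dΦ + A∪Φ − Φ∪A`. -/
def dA0 (A : Form1 N M) (Φ : Form0 N M) : Form1 N M :=
  d0 Φ + cup10 A Φ - cup01 Φ A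

/-- Covariant exterior derivative on 1-forms: `d_A Ω = dΩ + A∪Ω + Ω∪A`. -/
def dA1 (A : Form1 N M) (Ω : Form1 N M) : Form2 N M :=
  d1 Ω + cup11 A Ω + cup11 Ω A

/-- Adjoint covariant derivative on 1-forms:
`δ_A Ω = δΩ + ∗⁻¹(∗Ω ∪ ∗∗A − A ∪ ∗Ω)`. -/
def deltaA1 (A : Form1 N M) (Ω : Form1 N M) : Form0 N M :=
  delta1 Ω + starInv2 (cup11 (star1 Ω) (star1 (star1 A)) - cup11 A (star1 Ω))

/-- Adjoint covariant derivative on 2-forms: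
`δ_A Ψ = δΨ + ∗⁻¹(∗Ψ ∪ ∗∗A + A ∪ ∗Ψ)`. -/
def deltaA2 (A : Form1 N M) (Ψ : Form2 N M) : Form1 N M :=
  delta2 Ψ + starInv1 (cup01 (star2 Ψ) (star1 (star1 A)) + cup10 A (star2 Ψ))

/-- Covariant Laplacian on 0-forms (`δ_A` vanishes on 0-forms). -/
def lapA0 (A : Form1 N M) (Φ : Form0 N M) : Form0 N M := deltaA1 A (dA0 A Φ)

/-- Covariant Laplacian on 1-forms. -/
def lapA1 (A : Form1 N M) (Ω : Form1 N M) : Form1 N M :=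
  dA0 A (deltaA1 A Ω) + deltaA2 A (dA1 A Ω)

/-- Covariant Laplacian on 2-forms (`d_A` of a 2-form is a 3-form, hence zero). -/
def lapA2 (A : Form1 N M) (Ψ : Form2 N M) : Form2 N M := dA1 A (deltaA2 A Ψ)

/-- Discrete curvature of a 1-form `A`. -/
def curv (A : Form1 N M) : Form2 N M :=
  fun k s => A.2 (k + 1) s - A.2 k s - A.1 k (s + 1) + A.1 k s
    + A.1 k s * A.2 (k + 1) s - A.2 k s * A.1 k (s + 1)

/-- Inner product of 0-forms over the torus. -/
def inner0 [NeZero N] [NeZero M] (Φ Ω : Form0 N M) : ℂ :=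
  -(1 / 2) * ∑ k : ZMod N, ∑ s : ZMod M, Matrix.trace (Φ k s * Ω k s)

/-- Inner product of 1-forms over the torus. -/
def inner1 [NeZero N] [NeZero M] (Φ Ω : Form1 N M) : ℂ :=
  -(1 / 2) * ∑ k : ZMod N, ∑ s : ZMod M,
    Matrix.trace (Φ.1 k s * Ω.1 k s + Φ.2 k s * Ω.2 k s)

/-- Inner product of 2-forms over the torus. -/
def inner2 [NeZero N] [NeZero M] (Φ Ω : Form2 N M) : ℂ :=
  -(1 / 2) * ∑ k : ZMod N, ∑ s : ZMod M, Matrix.trace (Φ k s * Ω k s)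

/-- Pairing of a 2-form with the fundamental chain `V`: `⟨V,Ψ⟩ = Σ Ψ_{k,s}`. -/
def pairV [NeZero N] [NeZero M] (Ψ : Form2 N M) : Mat :=
  ∑ k : ZMod N, ∑ s : ZMod M, Ψ k s

/-- A matrix lies in su(2): traceless and skew-Hermitian. -/
def IsSU2 (X : Mat) : Prop := Matrix.trace X = 0 ∧ Xᴴ = -X

/-- An su(2)-valued 0-form (or 2-form). -/
def IsSU2Form0 (Φ : Form0 N M) : Prop := ∀ k s, IsSU2 (Φ k s)

/-- An su(2)-valued 1-form. -/
def IsSU2Form1 (Ω : Form1 N M) : Prop := ∀ k s, IsSU2 (Ω.1 k s) ∧ IsSU2 (Ω.2 k s)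

section Adjointness

variable [NeZero N] [NeZero M]

/-- Discrete divergence theorem: sums over the torus do not see total differences. -/
lemma sum_torus_eq_of_eq_add_diff {f g : ZMod N → ZMod M → ℂ} (U V : ZMod N → ZMod M → ℂ)
    (h : ∀ k s, f k s = g k s + (U (k + 1) s - U k s) + (V k (s + 1) - V k s)) :
    ∑ k, ∑ s, f k s = ∑ k, ∑ s, g k s := by
  have hU : ∑ k, ∑ s, U (k + 1) s = ∑ k, ∑ s, U k s :=
    Equiv.sum_comp (Equiv.addRight (1 : ZMod N)) fun k => ∑ s, U k s
  have hV : ∑ k, ∑ s, V k (s + 1) = ∑ k, ∑ s, V k s :=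
    Finset.sum_congr rfl fun k _ => Equiv.sum_comp (Equiv.addRight (1 : ZMod M)) (V k)
  simp only [h, Finset.sum_add_distrib, Finset.sum_sub_distrib, hU, hV, sub_self, add_zero]

lemma inner0_comm (Φ Ω : Form0 N M) : inner0 Φ Ω = inner0 Ω Φ := by
  simp only [inner0, Matrix.trace_mul_comm (Φ _ _)]

lemma inner1_comm (Φ Ω : Form1 N M) : inner1 Φ Ω = inner1 Ω Φ := by
  simp only [inner1, Matrix.trace_add, Matrix.trace_mul_comm (Φ.1 _ _),
    Matrix.trace_mul_comm (Φ.2 _ _)]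

lemma inner2_comm (Φ Ω : Form2 N M) : inner2 Φ Ω = inner2 Ω Φ :=
  inner0_comm Φ Ω

lemma inner1_add_left (Φ Ψ Ω : Form1 N M) :
    inner1 (Φ + Ψ) Ω = inner1 Φ Ω + inner1 Ψ Ω := by
  simp only [inner1, ← mul_add, ← Finset.sum_add_distrib, ← Matrix.trace_add, Prod.fst_add,
    Prod.snd_add, Pi.add_apply, add_mul, add_add_add_comm]

lemma inner1_add_right (Φ Ψ Ω : Form1 N M) :
    inner1 Φ (Ψ + Ω) = inner1 Φ Ψ + inner1 Φ Ω := by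
  rw [inner1_comm, inner1_add_left, inner1_comm Ψ, inner1_comm Ω]

/-- `deltaA1 A` is adjoint to `dA0 A`. -/
lemma inner1_dA0 (A : Form1 N M) (Φ : Form0 N M) (Ω : Form1 N M) :
    inner1 (dA0 A Φ) Ω = inner0 Φ (deltaA1 A Ω) := by
  unfold inner1 inner0
  congr 1
  refine sum_torus_eq_of_eq_add_diff
    (fun k s => trace (Φ k s * (Ω.1 (k - 1) s + Ω.1 (k - 1) s * A.1 (k - 1) s)))
    (fun k s => trace (Φ k s * (Ω.2 k (s - 1) + Ω.2 k (s - 1) * A.2 k (s - 1)))) fun k s => ?_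
  simp only [dA0, d0, cup10, cup01, deltaA1, delta1, starInv2, cup11, star1, Prod.fst_add,
    Prod.snd_add, Prod.fst_sub, Prod.snd_sub, Pi.add_apply, Pi.sub_apply, add_sub_cancel_right,
    trace_fin_two, mul_apply, Fin.sum_univ_two, Matrix.add_apply,
    Matrix.sub_apply, Matrix.neg_apply]
  ring

/-- `deltaA2 A` is adjoint to `dA1 A`. -/
lemma inner2_dA1 (A : Form1 N M) (Ω : Form1 N M) (Ψ : Form2 N M) :
    inner2 (dA1 A Ω) Ψ = inner1 Ω (deltaA2 A Ψ) := by
  unfold inner2 inner1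
  congr 1
  refine sum_torus_eq_of_eq_add_diff
    (fun k s => trace (Ω.2 k s * (Ψ (k - 1) s + Ψ (k - 1) s * A.1 (k - 1) s)))
    (fun k s => -trace (Ω.1 k s * (Ψ k (s - 1) + Ψ k (s - 1) * A.2 k (s - 1)))) fun k s => ?_
  simp only [dA1, d1, cup10, cup01, deltaA2, delta2, starInv1, star2, cup11, star1, Prod.fst_add,
    Prod.snd_add, Pi.add_apply, add_sub_cancel_right,
    trace_fin_two, mul_apply, Fin.sum_univ_two, Matrix.add_apply,
    Matrix.sub_apply, Matrix.neg_apply]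
  ring

end Adjointness

/-- the operator `Δ_A^c = d_A^c δ_A^c + δ_A^c d_A^c` is self-adjoint on
`r`-forms, `r = 0, 1, 2`. -/
theorem discrete_covariant_laplacian_selfadjoint (N M : ℕ) [NeZero N] [NeZero M]
    (A : Form1 N M) :
    (∀ Φ Ω : Form0 N M, inner0 (lapA0 A Φ) Ω = inner0 Φ (lapA0 A Ω)) ∧
    (∀ Φ Ω : Form1 N M, inner1 (lapA1 A Φ) Ω = inner1 Φ (lapA1 A Ω)) ∧
    (∀ Φ Ω : Form2 N M, inner2 (lapA2 A Φ) Ω = inner2 Φ (lapA2 A Ω)) := by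
  refine ⟨fun Φ Ω => ?_, fun Φ Ω => ?_, fun Φ Ω => ?_⟩
  · rw [lapA0, lapA0, ← inner1_dA0, inner0_comm, ← inner1_dA0, inner1_comm]
  · rw [lapA1, lapA1, inner1_add_left, inner1_add_right, inner1_dA0, inner1_comm Φ (dA0 _ _),
      inner1_dA0, inner0_comm, ← inner2_dA1, inner1_comm (deltaA2 _ _), ← inner2_dA1, inner2_comm]
  · rw [lapA2, lapA2, inner2_dA1, inner2_comm Φ, inner2_dA1, inner1_comm]
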